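/- Let G be a finite simple graph and W a minimal vertex cover of G. Then ⟨J_s(W)⟩ is a minimal prime of J_s(I(G)); that is, ⟨J_s(W)⟩ is a prime ideal containing J_s(I(G)) which is minimal among the prime ideals of J_sR containing J_s(I(G)). -/

import Mathlib

open MvPolynomial

/-- `W` is a vertex cover of `G`. -/
def IsVertexCover {V : Type*} (G : SimpleGraph V) (W : Set V) : Prop :=
  ∀ ⦃x y : V⦄, G.Adj x y → x ∈ W ∨ y ∈ W

/-- `W` is a minimal vertex cover of `G`. -/
def IsMinimalVertexCover {V : Type*} (G : SimpleGraph V) (W : Set V) : Prop :=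
  IsVertexCover G W ∧ ∀ W' : Set V, W' ⊂ W → ¬ IsVertexCover G W'

/-- The degree `m` part `α_m(x,y) = ∑_{i+j=m} X(x,i)·X(y,j)` of the image of the
edge monomial `xy` in the ring of `s`-jets. -/
noncomputable def jetsAlpha (k : Type*) [Field k] {V : Type*} (s : ℕ) (x y : V) (m : ℕ) :
    MvPolynomial (V × Fin (s + 1)) k :=
  ∑ ij ∈ Finset.univ.filter
      (fun ij : Fin (s + 1) × Fin (s + 1) => (ij.1 : ℕ) + (ij.2 : ℕ) = m),
    X (x, ij.1) * X (y, ij.2)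

/-- The `s`-jets `J_s(I(G))` of the edge ideal of `G`. -/
noncomputable def jetsEdgeIdeal (k : Type*) [Field k] {V : Type*} (G : SimpleGraph V)
    (s : ℕ) : Ideal (MvPolynomial (V × Fin (s + 1)) k) :=
  Ideal.span {f | ∃ x y : V, G.Adj x y ∧ ∃ m ≤ s, f = jetsAlpha k s x y m}

/-- `⟨J_s(W)⟩`: the ideal generated by the jets variables of the elements of `W`. -/
noncomputable def jetsVertexCoverIdeal (k : Type*) [Field k] {V : Type*} (s : ℕ)
    (W : Set V) : Ideal (MvPolynomial (V × Fin (s + 1)) k) :=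
  Ideal.span {f | ∃ x ∈ W, ∃ i : Fin (s + 1), f = X (x, i)}

theorem MvPolynomial.isPrime_span_X_image {σ R : Type*} [CommRing R] [IsDomain R] (S : Set σ) :
    (Ideal.span (X '' S : Set (MvPolynomial σ R))).IsPrime := by
  classical
  let φ : MvPolynomial σ R →ₐ[R] MvPolynomial σ R := aeval fun p => if p ∈ S then 0 else X p
  suffices h : Ideal.span (X '' S) = RingHom.ker φ by
    rw [h]
    exact RingHom.ker_isPrime φ
  apply le_antisymm
  · rw [Ideal.span_le]
    rintro _ ⟨p, hp, rfl⟩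
    simp [φ, hp]
  · intro f hf
    have hφ : (Ideal.Quotient.mkₐ R (Ideal.span (X '' S))).comp φ =
        Ideal.Quotient.mkₐ R (Ideal.span (X '' S)) := by
      ext p
      by_cases hp : p ∈ S
      · have hX : (X p : MvPolynomial σ R) ∈ Ideal.span (X '' S) :=
          Ideal.subset_span ⟨p, hp, rfl⟩
        simpa [φ, hp] using (Ideal.Quotient.eq_zero_iff_mem.2 hX).symm
      · simp [φ, hp]
    have hfφ := DFunLike.congr_fun hφ f
    rw [AlgHom.comp_apply, RingHom.mem_ker.1 hf, map_zero] at hfφ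
    exact Ideal.Quotient.eq_zero_iff_mem.1 hfφ.symm

theorem jetsVertexCoverIdeal_eq_span_image (k : Type*) [Field k] {V : Type*} (s : ℕ)
    (W : Set V) :
    jetsVertexCoverIdeal k s W =
      Ideal.span (X '' {p : V × Fin (s + 1) | p.1 ∈ W}) := by
  refine congrArg Ideal.span (Set.ext fun f => ⟨?_, ?_⟩)
  · rintro ⟨x, hx, i, rfl⟩
    exact ⟨(x, i), hx, rfl⟩
  · rintro ⟨⟨x, i⟩, hx, rfl⟩
    exact ⟨x, hx, i, rfl⟩

theorem X_mem_jetsVertexCoverIdeal_iff (k : Type*) [Field k] {V : Type*} (s : ℕ)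
    (W : Set V) (p : V × Fin (s + 1)) :
    (X p : MvPolynomial (V × Fin (s + 1)) k) ∈ jetsVertexCoverIdeal k s W ↔ p.1 ∈ W := by
  classical
  rw [jetsVertexCoverIdeal_eq_span_image, mem_ideal_span_X_image]
  simp only [support_X, Finset.mem_singleton, forall_eq, Finsupp.single_apply]
  simp only [ne_eq, ite_eq_right_iff, one_ne_zero, imp_false, not_not, exists_eq_right',
    Set.mem_ofPred_eq]

theorem jetsVertexCoverIdeal_isPrime (k : Type*) [Field k] {V : Type*} (s : ℕ) (W : Set V) :
    (jetsVertexCoverIdeal k s W).IsPrime := by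
  rw [jetsVertexCoverIdeal_eq_span_image]
  exact MvPolynomial.isPrime_span_X_image _

theorem jetsAlpha_comm (k : Type*) [Field k] {V : Type*} (s : ℕ) (x y : V) (m : ℕ) :
    jetsAlpha k s x y m = jetsAlpha k s y x m := by
  refine Finset.sum_equiv (Equiv.prodComm _ _) (fun ij => ?_) fun ij _ => mul_comm _ _
  simp [add_comm]

theorem jetsAlpha_mem_of_left {k : Type*} [Field k] {V : Type*} {s : ℕ} {x : V}
    {I : Ideal (MvPolynomial (V × Fin (s + 1)) k)} (hx : ∀ i, X (x, i) ∈ I) (y : V) (m : ℕ) :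
    jetsAlpha k s x y m ∈ I :=
  I.sum_mem fun ij _ => I.mul_mem_right _ (hx ij.1)

theorem jetsEdgeIdeal_le_jetsVertexCoverIdeal (k : Type*) [Field k] {V : Type*}
    {G : SimpleGraph V} (s : ℕ) {W : Set V} (hW : IsVertexCover G W) :
    jetsEdgeIdeal k G s ≤ jetsVertexCoverIdeal k s W := by
  refine Ideal.span_le.2 ?_
  rintro _ ⟨x, y, hxy, m, -, rfl⟩
  rcases hW hxy with h | h
  · exact jetsAlpha_mem_of_left (fun i => (X_mem_jetsVertexCoverIdeal_iff k s W _).2 h) y m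
  · rw [jetsAlpha_comm]
    exact jetsAlpha_mem_of_left (fun i => (X_mem_jetsVertexCoverIdeal_iff k s W _).2 h) x m

theorem IsMinimalVertexCover.exists_adj_notMem {V : Type*} {G : SimpleGraph V} {W : Set V}
    (hW : IsMinimalVertexCover G W) {x : V} (hx : x ∈ W) : ∃ y ∉ W, G.Adj x y := by
  by_contra! h
  refine hW.2 (W \ {x}) ⟨Set.sdiff_subset, fun hsub => (hsub hx).2 rfl⟩ fun a b hab => ?_
  have hcover := hW.1 hab
  have := hab.ne
  have := hab.symm
  by_cases ha : a = x <;> by_cases hb : b = x <;> grind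

theorem X_mem_of_jetsAlpha_mem {k : Type*} [Field k] {V : Type*} {s : ℕ} {x y : V}
    {Q : Ideal (MvPolynomial (V × Fin (s + 1)) k)} (hQ : Q.IsPrime) (hy : X (y, 0) ∉ Q)
    (hα : ∀ m ≤ s, jetsAlpha k s x y m ∈ Q) (i : Fin (s + 1)) : X (x, i) ∈ Q := by
  induction i using WellFoundedLT.induction with
  | ind i ih =>
    refine (hQ.mem_or_mem ?_).resolve_right hy
    have hi := hα i (Nat.lt_succ_iff.1 i.2)
    rw [jetsAlpha, ← Finset.add_sum_erase _ _ (a := (i, 0)) (by simp)] at hi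
    refine (Q.add_mem_iff_left (Q.sum_mem fun ij hij => Q.mul_mem_right _ (ih ij.1 ?_))).1 hi
    simp only [Finset.mem_erase, Finset.mem_filter, Finset.mem_univ, true_and, ne_eq,
      Prod.ext_iff, Fin.ext_iff, Fin.val_zero] at hij
    rw [Fin.lt_def]
    omega

theorem jetsVertexCoverIdeal_mem_minimalPrimes (k : Type*) [Field k]
    {V : Type*} [Fintype V] (G : SimpleGraph V) (s : ℕ) (W : Set V)
    (hW : IsMinimalVertexCover G W) :
    jetsVertexCoverIdeal k s W ∈ (jetsEdgeIdeal k G s).minimalPrimes := by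
  refine ⟨⟨jetsVertexCoverIdeal_isPrime k s W, jetsEdgeIdeal_le_jetsVertexCoverIdeal k s hW.1⟩,
    fun Q ⟨hQ, hJQ⟩ hQW => Ideal.span_le.2 ?_⟩
  rintro _ ⟨x, hx, i, rfl⟩
  obtain ⟨y, hy, hxy⟩ := hW.exists_adj_notMem hx
  exact X_mem_of_jetsAlpha_mem hQ
    (fun h => hy ((X_mem_jetsVertexCoverIdeal_iff k s W _).1 (hQW h)))
    (fun m hm => hJQ (Ideal.subset_span ⟨x, y, hxy, m, hm, rfl⟩)) i
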